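/- arXiv:1610.04838 — 3 statements merged into one kernel-verified Lean document; each statement's English description precedes it below -/
import Mathlib

section
/- For every finite simple undirected graph G=(V,E) with threshold function t : V → ℕ, there exists a target set S for (G,t) whose cardinality satisfies |S| ≤ ∑_{v∈V} min(1, t(v)/(d(v)+1)), where the sum is taken over the rationals (equivalently, the reals). -/
open scoped Classical

noncomputable section

variable {V : Type*}

/-- The in-neighborhood of `u` in the digraph with arc relation `E`.
For an undirected graph `G` we use `E = G.Adj`, so this is the ordinary neighborhood. -/
def inNbrs [Fintype V] (E : V → V → Prop) (u : V) : Finset V :=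
  Finset.univ.filter fun w => E w u

/-- The activation process: `activeProcess E t S ℓ = Active[S, ℓ]`. -/
def activeProcess [Fintype V] (E : V → V → Prop) (t : V → ℕ) (S : Finset V) : ℕ → Finset V
  | 0 => S
  | ℓ + 1 =>
      activeProcess E t S ℓ ∪
        Finset.univ.filter fun u => t u ≤ (inNbrs E u ∩ activeProcess E t S ℓ).card

/-- `S` is a target set for the digraph with arc relation `E` and thresholds `t`. -/
def IsTargetSet [Fintype V] (E : V → V → Prop) (t : V → ℕ) (S : Finset V) : Prop :=
  ∃ ℓ : ℕ, activeProcess E t S ℓ = Finset.univ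

open Finset

theorem subset_activeProcess_succ [Fintype V] (E : V → V → Prop) (t : V → ℕ) (S : Finset V)
    (ℓ : ℕ) : activeProcess E t S ℓ ⊆ activeProcess E t S (ℓ + 1) :=
  subset_union_left

theorem activeProcess_mono [Fintype V] (E : V → V → Prop) (t : V → ℕ) (ℓ : ℕ) :
    Monotone fun S : Finset V => activeProcess E t S ℓ := by
  intro S T hST
  induction ℓ with
  | zero => exact hST
  | succ ℓ ih =>
    refine union_subset_union ih fun u hu => ?_
    rw [mem_filter] at hu ⊢
    exact ⟨hu.1, hu.2.trans (card_le_card (inter_subset_inter_left ih))⟩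

theorem subset_activeProcess [Fintype V] (E : V → V → Prop) (t : V → ℕ) (S : Finset V)
    (ℓ : ℕ) : S ⊆ activeProcess E t S ℓ := by
  induction ℓ with
  | zero => exact Subset.rfl
  | succ ℓ ih => exact ih.trans (subset_activeProcess_succ E t S ℓ)

theorem mem_activeProcess_succ_of_le [Fintype V] {E : V → V → Prop} {t : V → ℕ}
    {S : Finset V} {ℓ : ℕ} {u : V} (h : t u ≤ #(inNbrs E u ∩ activeProcess E t S ℓ)) :
    u ∈ activeProcess E t S (ℓ + 1) :=
  mem_union_right _ (mem_filter.2 ⟨mem_univ u, h⟩)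

/-- The probability that fewer than `t u` in-neighbors of `u` inside `U` precede `u` in a
uniformly random linear order. -/
def seedWeight [Fintype V] (E : V → V → Prop) (t : V → ℕ) (U : Finset V) (u : V) : ℚ :=
  min 1 ((t u : ℚ) / ((#(inNbrs E u ∩ U) : ℚ) + 1))

theorem mul_min_one_div_add_ite_le (d t : ℕ) :
    (d : ℚ) * min 1 ((t : ℚ) / d) + (if d < t then 1 else 0) ≤
      ((d : ℚ) + 1) * min 1 ((t : ℚ) / ((d : ℚ) + 1)) := by
  have hd : (0 : ℚ) ≤ d := d.cast_nonneg
  rw [mul_min_of_nonneg _ _ hd, mul_min_of_nonneg _ _ (by positivity : (0 : ℚ) ≤ d + 1),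
    mul_div_cancel₀ _ (by positivity : (d : ℚ) + 1 ≠ 0)]
  have hdt : (d : ℚ) * (t / d) ≤ t := by
    rcases eq_or_ne (d : ℚ) 0 with h | h
    · simp [h]
    · exact (mul_div_cancel₀ _ h).le
  split_ifs with h
  · have h' : (d : ℚ) + 1 ≤ t := by exact_mod_cast h
    rw [mul_one, mul_one, min_eq_left h']
    linarith [min_le_left (d : ℚ) (d * (t / d))]
  · have h' : (t : ℚ) ≤ d := by exact_mod_cast not_lt.1 h
    rw [mul_one, mul_one, min_eq_right (by linarith : (t : ℚ) ≤ d + 1)]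
    linarith [min_le_right (d : ℚ) (d * (t / d))]

theorem seedWeight_erase [Fintype V] (E : V → V → Prop) (t : V → ℕ) {U : Finset V} (u : V)
    {v : V} (hv : v ∈ U) :
    seedWeight E t (U.erase v) u = seedWeight E t U u +
      if v ∈ inNbrs E u then
        min 1 ((t u : ℚ) / (#(inNbrs E u ∩ U) : ℚ)) - seedWeight E t U u else 0 := by
  split_ifs with h
  · rw [seedWeight, inter_erase]
    have hc := card_erase_add_one (mem_inter.2 ⟨h, hv⟩)
    rw [← hc]
    push_cast
    ring
  · rw [seedWeight, inter_erase, erase_eq_of_notMem fun h' => h (mem_inter.1 h').1, add_zero,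
      seedWeight]

theorem sum_seedWeight_erase_le [Fintype V] {E : V → V → Prop} (hE : ∀ v, ¬E v v) (t : V → ℕ)
    {U : Finset V} {u : V} (hu : u ∈ U) :
    ∑ v ∈ U.erase u, seedWeight E t (U.erase v) u +
        (if #(inNbrs E u ∩ U) < t u then 1 else 0) ≤ #U * seedWeight E t U u := by
  have hN : (U.erase u).filter (· ∈ inNbrs E u) = inNbrs E u ∩ U := by
    ext v
    simp only [mem_filter, mem_erase, mem_inter, inNbrs, mem_univ, true_and]
    refine ⟨fun h => ⟨h.2, h.1.2⟩, fun h => ⟨⟨?_, h.2⟩, h.1⟩⟩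
    rintro rfl
    exact hE v h.1
  have hU : (#(U.erase u) : ℚ) + 1 = #U := by exact_mod_cast card_erase_add_one hu
  have hmin := mul_min_one_div_add_ite_le #(inNbrs E u ∩ U) (t u)
  rw [sum_congr rfl fun v hv => seedWeight_erase E t u (mem_of_mem_erase hv), sum_add_distrib,
    ← sum_filter, hN, sum_const, sum_const, nsmul_eq_mul, nsmul_eq_mul, ← hU]
  change _ ≤ _ * seedWeight E t U u at hmin
  linarith

/-- Some vertex of `U` can be placed last without exceeding the total weight. -/
theorem exists_seedWeight_erase_le [Fintype V] {E : V → V → Prop} (hE : ∀ v, ¬E v v)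
    (t : V → ℕ) {U : Finset V} (hU : U.Nonempty) :
    ∃ v ∈ U, ∑ u ∈ U.erase v, seedWeight E t (U.erase v) u +
        (if #(inNbrs E v ∩ U) < t v then 1 else 0) ≤ ∑ u ∈ U, seedWeight E t U u := by
  refine exists_le_of_sum_le hU ?_
  rw [sum_add_distrib, sum_const, nsmul_eq_mul, mul_sum,
    sum_comm' (t' := U) (s' := fun u => U.erase u) (by simp only [mem_erase]; tauto),
    ← sum_add_distrib]
  exact sum_le_sum fun u hu => sum_seedWeight_erase_le hE t hu

theorem exists_subset_activeProcess [Fintype V] {E : V → V → Prop} (hE : ∀ v, ¬E v v)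
    (t : V → ℕ) (U : Finset V) :
    ∃ S : Finset V, (∃ ℓ, U ⊆ activeProcess E t S ℓ) ∧
      (#S : ℚ) ≤ ∑ u ∈ U, seedWeight E t U u := by
  induction U using Finset.strongInduction with
  | H U ih =>
    rcases U.eq_empty_or_nonempty with rfl | hU
    · exact ⟨∅, ⟨0, empty_subset _⟩, by simp⟩
    obtain ⟨v, hv, hle⟩ := exists_seedWeight_erase_le hE t hU
    obtain ⟨S, ⟨ℓ, hS⟩, hcard⟩ := ih _ (erase_ssubset hv)
    split_ifs at hle with h
    · refine ⟨insert v S, ⟨ℓ, fun u hu => ?_⟩, ?_⟩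
      · by_cases huv : u = v
        · exact subset_activeProcess E t _ ℓ (huv ▸ mem_insert_self v S)
        · exact activeProcess_mono E t ℓ (subset_insert v S) (hS (mem_erase.2 ⟨huv, hu⟩))
      · have : (#(insert v S) : ℚ) ≤ #S + 1 := by exact_mod_cast card_insert_le v S
        linarith
    · refine ⟨S, ⟨ℓ + 1, fun u hu => ?_⟩, by linarith⟩
      by_cases huv : u = v
      · subst huv
        refine mem_activeProcess_succ_of_le ((not_lt.1 h).trans (card_le_card fun w hw => ?_))
        rw [mem_inter] at hw ⊢
        refine ⟨hw.1, hS (mem_erase.2 ⟨?_, hw.2⟩)⟩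
        rintro rfl
        exact hE w (mem_filter.1 hw.1).2
      · exact subset_activeProcess_succ E t S ℓ (hS (mem_erase.2 ⟨huv, hu⟩))

/-- There is a target set of size at most `∑_{v ∈ V} min(1, t(v)/(d(v)+1))`. -/
theorem exists_target_set_le_sum_min [Fintype V] (G : SimpleGraph V) (t : V → ℕ) :
    ∃ S : Finset V, IsTargetSet G.Adj t S ∧
      (S.card : ℚ) ≤ ∑ v : V, min 1 ((t v : ℚ) / ((G.degree v : ℚ) + 1)) := by
  obtain ⟨S, ⟨ℓ, hS⟩, hcard⟩ := exists_subset_activeProcess (fun _ => G.irrefl) t univ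
  refine ⟨S, ⟨ℓ, univ_subset_iff.1 hS⟩, hcard.trans_eq (sum_congr rfl fun v _ => ?_)⟩
  have hdeg : inNbrs G.Adj v = G.neighborFinset v := by
    ext w
    simp [inNbrs, G.adj_comm]
  rw [seedWeight, inter_univ, hdeg, G.card_neighborFinset_eq_degree]
end
end

section
/- Let G=(V,E) be an Ore graph on n ≥ 2 vertices. Then the number of vertices of degree less than n/2 is strictly smaller than the number of vertices of degree at least n/2; that is, |{v ∈ V : d(v) < n/2}| < |{v ∈ V : d(v) ≥ n/2}|. -/
open scoped Classical

noncomputable section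

variable {V : Type*}

/-- In an Ore graph on at least two vertices, there are strictly fewer vertices of degree
`< n/2` than vertices of degree `≥ n/2`. -/
theorem ore_low_degree_lt_high_degree [Fintype V] (G : SimpleGraph V)
    (hn : 2 ≤ Fintype.card V)
    (hOre : ∀ u v : V, u ≠ v → ¬ G.Adj u v → Fintype.card V ≤ G.degree u + G.degree v) :
    (Finset.univ.filter fun v : V => 2 * G.degree v < Fintype.card V).card <
      (Finset.univ.filter fun v : V => Fintype.card V ≤ 2 * G.degree v).card := by
  set L := Finset.univ.filter fun v : V => 2 * G.degree v < Fintype.card V with hL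
  set H := Finset.univ.filter fun v : V => Fintype.card V ≤ 2 * G.degree v with hH
  have hmemL (v : V) : v ∈ L ↔ 2 * G.degree v < Fintype.card V := by simp [hL]
  have hmemH (v : V) : v ∈ H ↔ Fintype.card V ≤ 2 * G.degree v := by simp [hH]
  have hcard : L.card + H.card = Fintype.card V := by
    simpa only [hL, hH, not_lt, Finset.card_univ] using
      Finset.card_filter_add_card_filter_not (s := (Finset.univ : Finset V))
        (fun v => 2 * G.degree v < Fintype.card V)
  by_contra! hle
  -- The low-degree vertices form a clique.
  have hsub : ∀ v ∈ L, L.erase v ⊆ G.neighborFinset v := by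
    intro v hv w hw
    obtain ⟨hne, hwL⟩ := Finset.mem_erase.mp hw
    rw [SimpleGraph.mem_neighborFinset]
    by_contra hadj
    have hsum := hOre v w hne.symm hadj
    rw [hmemL] at hv hwL
    omega
  have hnbr : ∀ v ∈ L, L.erase v = G.neighborFinset v := by
    intro v hv
    refine Finset.eq_of_subset_of_card_le (hsub v hv) ?_
    rw [Finset.card_erase_of_mem hv, G.card_neighborFinset_eq_degree]
    have hlow := (hmemL v).mp hv
    omega
  obtain ⟨v, hv⟩ : L.Nonempty := Finset.card_pos.mp (by omega)
  have hdegv : G.degree v = L.card - 1 := by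
    rw [← G.card_neighborFinset_eq_degree, ← hnbr v hv, Finset.card_erase_of_mem hv]
  have hlow := (hmemL v).mp hv
  obtain ⟨u, hu⟩ : H.Nonempty := Finset.card_pos.mp (by omega)
  have hhigh := (hmemH u).mp hu
  have hdisj : ∀ w ∈ L, ¬ G.Adj w u := by
    intro w hw hadj
    rw [← SimpleGraph.mem_neighborFinset, ← hnbr w hw, Finset.mem_erase, hmemL] at hadj
    omega
  have hdegu : G.degree u ≤ H.card - 1 := by
    rw [← G.card_neighborFinset_eq_degree, ← Finset.card_erase_of_mem hu]
    refine Finset.card_le_card fun w hw => ?_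
    rw [SimpleGraph.mem_neighborFinset] at hw
    refine Finset.mem_erase.mpr ⟨hw.ne', (hmemH w).mpr ?_⟩
    by_contra! hwL
    exact hdisj w ((hmemL w).mpr hwL) hw.symm
  have hsum := hOre v u (by rintro rfl; omega) (hdisj v hv)
  omega
end
end

section
/- Let G=(V,E) be a finite directed graph with threshold function t : V → ℕ, and let v ∈ V satisfy t(v) = 0. Let G' be the subdigraph of G induced by V \ {v}, with threshold function t' defined by t'(u) = max(t(u) − 1, 0) if u is an out-neighbor of v in G, and t'(u) = t(u) otherwise. If S ⊆ V \ {v} is a target set for (G',t'), then S is a target set for (G,t). -/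
open scoped Classical

noncomputable section

variable {V : Type*}

theorem mem_activeProcess_succ [Fintype V] {E : V → V → Prop} {t : V → ℕ} {S : Finset V}
    {ℓ : ℕ} {u : V} :
    u ∈ activeProcess E t S (ℓ + 1) ↔
      u ∈ activeProcess E t S ℓ ∨ t u ≤ (inNbrs E u ∩ activeProcess E t S ℓ).card := by
  simp [activeProcess]

theorem mem_activeProcess_succ_of_threshold_eq_zero [Fintype V] {E : V → V → Prop} {t : V → ℕ}
    {v : V} (hv : t v = 0) (S : Finset V) (ℓ : ℕ) : v ∈ activeProcess E t S (ℓ + 1) :=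
  mem_activeProcess_succ.2 (Or.inr (by simp [hv]))

/-- The process on the subdigraph without the zero-threshold vertex `v` is at most one round
ahead of the process on the whole digraph. -/
theorem mem_activeProcess_of_mem_removed [Fintype V] {E : V → V → Prop} {t : V → ℕ}
    {v : V} (hv : t v = 0) (S : Finset V) (ℓ : ℕ) (u : {u : V // u ≠ v})
    (hu : u ∈ activeProcess (fun a b : {u : V // u ≠ v} => E a b)
      (fun u : {u : V // u ≠ v} => if E v u then t u - 1 else t u) (S.subtype (· ≠ v)) ℓ) :
    (u : V) ∈ activeProcess E t S (ℓ + 1) := by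
  induction ℓ generalizing u with
  | zero =>
    exact mem_activeProcess_succ.2 (Or.inl (by simpa [activeProcess] using hu))
  | succ ℓ ih =>
    rw [mem_activeProcess_succ] at hu ⊢
    refine hu.imp (ih u) fun h => ?_
    obtain ⟨A, hA, h⟩ : ∃ A : Finset {u : V // u ≠ v},
        (∀ w ∈ A, E w u ∧ (w : V) ∈ activeProcess E t S (ℓ + 1)) ∧
          (if E v u then t u - 1 else t u) ≤ A.card := by
      refine ⟨_, fun w hw => ?_, h⟩
      obtain ⟨hwE, hwA⟩ := (@Finset.mem_inter _ (_) _ _ _).1 hw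
      exact ⟨by simpa [inNbrs] using hwE, ih w hwA⟩
    have hvA : v ∉ A.map (Function.Embedding.subtype _) := by simp
    have hsub : A.map (Function.Embedding.subtype _) ⊆
        inNbrs E u ∩ activeProcess E t S (ℓ + 1) := by
      intro w hw
      obtain ⟨x, hx, rfl⟩ := Finset.mem_map.1 hw
      exact Finset.mem_inter.2 ⟨by simpa [inNbrs] using (hA x hx).1, (hA x hx).2⟩
    by_cases hE : E v u
    · have hcard := Finset.card_le_card (Finset.insert_subset (Finset.mem_inter.2
        ⟨by simpa [inNbrs] using hE,
          mem_activeProcess_succ_of_threshold_eq_zero hv S ℓ⟩) hsub)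
      rw [Finset.card_insert_of_notMem hvA, Finset.card_map] at hcard
      rw [if_pos hE] at h
      omega
    · have hcard := Finset.card_le_card hsub
      rw [Finset.card_map] at hcard
      rw [if_neg hE] at h
      exact h.trans hcard

/-- If `t(v) = 0`, then any target set for the subdigraph induced by `V \ {v}`
(with the thresholds of the out-neighbors of `v` lowered by one) is also a target set
for the original digraph. -/
theorem target_set_of_zero_threshold_removed [Fintype V] (E : V → V → Prop) (t : V → ℕ)
    (v : V) (hv : t v = 0) (S : Finset V) (hvS : v ∉ S)
    (hS : IsTargetSet (fun a b : {u : V // u ≠ v} => E a b)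
        (fun u : {u : V // u ≠ v} => if E v u then t u - 1 else t u)
        (S.subtype (· ≠ v))) :
    IsTargetSet E t S := by
  obtain ⟨ℓ, hℓ⟩ := hS
  refine ⟨ℓ + 1, Finset.eq_univ_iff_forall.2 fun u => ?_⟩
  by_cases huv : u = v
  · exact huv ▸ mem_activeProcess_succ_of_threshold_eq_zero hv S ℓ
  · exact mem_activeProcess_of_mem_removed hv S ℓ ⟨u, huv⟩ (hℓ ▸ Finset.mem_univ _)
end
end
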